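/- Define J^L(x) := g_L^{-1} S(x) g_L and J^R(x) := g_L S^{-1}(x) g_L^{-1}. Then the pulling-through identities hold in A ⊗ A: for all x, y ∈ A, J^L(x) Ω_{(1)} ⊗ Ω_{(2)} = Ω_{(1)} ⊗ x Ω_{(2)}, and Ω_{(1)} J^R(y) ⊗ Ω_{(2)} = Ω_{(1)} ⊗ Ω_{(2)} y. -/

import Mathlib

open scoped TensorProduct

noncomputable section

/-- An element of a `C*`-algebra is positive iff it is of the form `star y * y`. -/
def IsPosElem {A : Type*} [Mul A] [Star A] (x : A) : Prop := ∃ y : A, x = star y * y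

section Helpers

variable {A : Type*} [NormedRing A] [StarRing A] [CStarRing A]
  [NormedAlgebra ℂ A] [StarModule ℂ A]

/-- Apply a linear functional to the first leg of a tensor (`⟨φ, u₁⟩ u₂`). -/
def lapp (φ : A →ₗ[ℂ] ℂ) : A ⊗[ℂ] A →ₗ[ℂ] A :=
  (TensorProduct.lid ℂ A).toLinearMap ∘ₗ TensorProduct.map φ LinearMap.id

/-- Apply a linear functional to the second leg of a tensor (`⟨φ, u₂⟩ u₁`). -/
def rapp (φ : A →ₗ[ℂ] ℂ) : A ⊗[ℂ] A →ₗ[ℂ] A :=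
  (TensorProduct.rid ℂ A).toLinearMap ∘ₗ TensorProduct.map LinearMap.id φ

/-- Apply a pair of linear functionals to the two legs of a tensor (`⟨φ, u₁⟩⟨ψ, u₂⟩`). -/
def papp (φ ψ : A →ₗ[ℂ] ℂ) : A ⊗[ℂ] A →ₗ[ℂ] ℂ :=
  (TensorProduct.lid ℂ ℂ).toLinearMap ∘ₗ TensorProduct.map φ ψ

end Helpers

/-- A `C*`-weak Hopf algebra: a finite-dimensional unital `C*`-algebra `A` equipped with a
comultiplication `Δ` (written in Sweedler notation `Δ x = x₍₁₎ ⊗ x₍₂₎`), counit `ε` and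
antipode `S`, satisfying the axioms of Böhm–Szlachányi.  The field `starT` is the
(componentwise) star operation on `A ⊗[ℂ] A`, characterized by additivity and its values on
pure tensors. -/
structure WeakHopfData (A : Type*) [NormedRing A] [StarRing A] [CStarRing A]
    [NormedAlgebra ℂ A] [StarModule ℂ A] [FiniteDimensional ℂ A] : Type _ where
  Δ : A →ₗ[ℂ] A ⊗[ℂ] A
  ε : A →ₗ[ℂ] ℂ
  S : A ≃ₗ[ℂ] A
  starT : A ⊗[ℂ] A → A ⊗[ℂ] A
  starT_add : ∀ u v : A ⊗[ℂ] A, starT (u + v) = starT u + starT v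
  starT_tmul : ∀ a b : A, starT (a ⊗ₜ[ℂ] b) = star a ⊗ₜ[ℂ] star b
  /-- coassociativity of the comultiplication -/
  coassoc : (TensorProduct.assoc ℂ A A A).toLinearMap ∘ₗ
      (TensorProduct.map Δ LinearMap.id) ∘ₗ Δ = (TensorProduct.map LinearMap.id Δ) ∘ₗ Δ
  /-- counit axiom, left version -/
  counit_left : (TensorProduct.lid ℂ A).toLinearMap ∘ₗ (TensorProduct.map ε LinearMap.id) ∘ₗ Δ
      = LinearMap.id
  /-- counit axiom, right version -/
  counit_right : (TensorProduct.rid ℂ A).toLinearMap ∘ₗ (TensorProduct.map LinearMap.id ε) ∘ₗ Δ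
      = LinearMap.id
  /-- the comultiplication is multiplicative -/
  Δ_mul : ∀ x y : A, Δ (x * y) = Δ x * Δ y
  /-- the star operation is comultiplicative -/
  Δ_star : ∀ x : A, Δ (star x) = starT (Δ x)
  /-- the unit is weakly comultiplicative:
  `(Δ ⊗ id)(Δ 1) = (Δ 1 ⊗ 1)(1 ⊗ Δ 1)` -/
  Δ_one_weak : (TensorProduct.map Δ LinearMap.id) (Δ 1)
      = (Δ 1 ⊗ₜ[ℂ] (1 : A)) * ((TensorProduct.assoc ℂ A A A).symm ((1 : A) ⊗ₜ[ℂ] Δ 1))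
  /-- the unit is weakly comultiplicative:
  `(Δ ⊗ id)(Δ 1) = (1 ⊗ Δ 1)(Δ 1 ⊗ 1)` -/
  Δ_one_weak' : (TensorProduct.map Δ LinearMap.id) (Δ 1)
      = ((TensorProduct.assoc ℂ A A A).symm ((1 : A) ⊗ₜ[ℂ] Δ 1)) * (Δ 1 ⊗ₜ[ℂ] (1 : A))
  /-- the counit is weakly multiplicative: `ε (x y z) = ε (x y₍₁₎) ε (y₍₂₎ z)` -/
  ε_weak : ∀ x y z : A,
      ε (x * y * z) = papp (ε ∘ₗ LinearMap.mulLeft ℂ x) (ε ∘ₗ LinearMap.mulRight ℂ z) (Δ y)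
  /-- the counit is weakly multiplicative: `ε (x y z) = ε (x y₍₂₎) ε (y₍₁₎ z)` -/
  ε_weak' : ∀ x y z : A,
      ε (x * y * z) = papp (ε ∘ₗ LinearMap.mulRight ℂ z) (ε ∘ₗ LinearMap.mulLeft ℂ x) (Δ y)
  /-- antipode axiom: `x₍₁₎ S(x₍₂₎) = ε (1₍₁₎ x) 1₍₂₎` -/
  antipode_left : ∀ x : A,
      LinearMap.mul' ℂ A ((TensorProduct.map LinearMap.id S.toLinearMap) (Δ x))
        = lapp (ε ∘ₗ LinearMap.mulRight ℂ x) (Δ 1)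
  /-- antipode axiom: `S(x₍₁₎) x₍₂₎ = 1₍₁₎ ε (x 1₍₂₎)` -/
  antipode_right : ∀ x : A,
      LinearMap.mul' ℂ A ((TensorProduct.map S.toLinearMap LinearMap.id) (Δ x))
        = rapp (ε ∘ₗ LinearMap.mulLeft ℂ x) (Δ 1)
  /-- the antipode is antimultiplicative -/
  S_antimul : ∀ x y : A, S (x * y) = S y * S x
  /-- the antipode is anticomultiplicative -/
  S_anticomul : ∀ x : A,
      Δ (S x) = (TensorProduct.comm ℂ A A) ((TensorProduct.map S.toLinearMap S.toLinearMap) (Δ x))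

namespace WeakHopfData

variable {A : Type*} [NormedRing A] [StarRing A] [CStarRing A]
  [NormedAlgebra ℂ A] [StarModule ℂ A] [FiniteDimensional ℂ A]

/-- The source counital map `ε^L (x) = x₍₁₎ S(x₍₂₎)`. -/
def εL (W : WeakHopfData A) : A →ₗ[ℂ] A :=
  LinearMap.mul' ℂ A ∘ₗ TensorProduct.map LinearMap.id W.S.toLinearMap ∘ₗ W.Δ

/-- The target counital map `ε^R (x) = S(x₍₁₎) x₍₂₎`. -/
def εR (W : WeakHopfData A) : A →ₗ[ℂ] A :=
  LinearMap.mul' ℂ A ∘ₗ TensorProduct.map W.S.toLinearMap LinearMap.id ∘ₗ W.Δ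

/-- Full contraction of the iterated coproduct `Δ⁽ⁿ⁾ x = x₍₁₎ ⊗ ⋯ ⊗ x₍ₙ₊₁₎` against a family
of `n+1` linear functionals: `sweedlerEval W n φ x = ⟨φ 0, x₍₁₎⟩ ⋯ ⟨φ n, x₍ₙ₊₁₎⟩`.
Since linear functionals separate the points of a tensor power, identities between iterated
coproducts are faithfully expressed through these contractions. -/
def sweedlerEval (W : WeakHopfData A) : (n : ℕ) → (Fin (n + 1) → (A →ₗ[ℂ] ℂ)) → (A →ₗ[ℂ] ℂ)
  | 0, φ => φ 0
  | n + 1, φ => papp (sweedlerEval W n (Fin.init φ)) (φ (Fin.last (n + 1))) ∘ₗ W.Δ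

end WeakHopfData

/-- A `C*`-weak Hopf algebra together with its canonical distinguished elements:
the Haar integral `h`, the dual Haar integral `hHat`, the square roots `gL`, `gR` of
`E^L h`, `E^R h` (whence the canonical grouplike element `g = gL * gR⁻¹`), real powers
`gLpow`, `gRpow` of `gL` and `gR`, and a positive square root operation `sqrt`;
all characterized by the (uniquely determining) properties listed as fields. -/
structure HaarPkg (A : Type*) [NormedRing A] [StarRing A] [CStarRing A]
    [NormedAlgebra ℂ A] [StarModule ℂ A] [FiniteDimensional ℂ A] : Type _ where
  W : WeakHopfData A
  /-- the Haar integral -/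
  h : A
  haar_left : ∀ x : A, x * h = WeakHopfData.εL W x * h
  haar_right : ∀ x : A, h * x = h * WeakHopfData.εR W x
  haar_counitL : WeakHopfData.εL W h = 1
  haar_counitR : WeakHopfData.εR W h = 1
  haar_idem : h * h = h
  haar_star : star h = h
  haar_S : W.S h = h
  haar_nondeg : ∀ y : A, ∃ φ ψ : A →ₗ[ℂ] ℂ, lapp φ (W.Δ h) = y ∧ rapp ψ (W.Δ h) = y
  /-- the Haar integral of the dual weak Hopf algebra `A*`, as a linear functional on `A` -/
  hHat : A →ₗ[ℂ] ℂ
  hHat_pos : ∀ x : A, ∃ r : ℝ, 0 ≤ r ∧ hHat (star x * x) = (r : ℂ)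
  hHat_S : ∀ x : A, hHat (W.S x) = hHat x
  /-- `gL = (E^L h)^{1/2}` -/
  gL : A
  /-- `gR = (E^R h)^{1/2}` -/
  gR : A
  gL_pos : IsPosElem gL
  gR_pos : IsPosElem gR
  gL_unit : IsUnit gL
  gR_unit : IsUnit gR
  gL_sq : gL * gL = rapp hHat (W.Δ h)
  gR_sq : gR * gR = lapp hHat (W.Δ h)
  gL_mem : gL ∈ Set.range (WeakHopfData.εL W)
  gR_mem : gR ∈ Set.range (WeakHopfData.εR W)
  gR_S : gR = W.S gL
  gLR_comm : gL * gR = gR * gL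
  /-- the canonical grouplike element `g = gL * gR⁻¹` is positive -/
  g_pos : IsPosElem (gL * Ring.inverse gR)
  g_unit : IsUnit (gL * Ring.inverse gR)
  /-- `Δ g = (g ⊗ g) Δ 1` -/
  g_grouplike : W.Δ (gL * Ring.inverse gR)
      = ((gL * Ring.inverse gR) ⊗ₜ[ℂ] (gL * Ring.inverse gR)) * W.Δ 1
  /-- `Δ g = Δ 1 (g ⊗ g)` -/
  g_grouplike' : W.Δ (gL * Ring.inverse gR)
      = W.Δ 1 * ((gL * Ring.inverse gR) ⊗ₜ[ℂ] (gL * Ring.inverse gR))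
  /-- `S g = g⁻¹` -/
  g_S : W.S (gL * Ring.inverse gR) = Ring.inverse (gL * Ring.inverse gR)
  /-- `S² x = g x g⁻¹` -/
  S_sq : ∀ x : A,
      W.S (W.S x) = (gL * Ring.inverse gR) * x * Ring.inverse (gL * Ring.inverse gR)
  /-- `h₍₁₎ ⊗ g h₍₂₎ g = h₍₂₎ ⊗ h₍₁₎` -/
  haar_flip : TensorProduct.map LinearMap.id
      (LinearMap.mulLeft ℂ (gL * Ring.inverse gR) ∘ₗ LinearMap.mulRight ℂ (gL * Ring.inverse gR))
      (W.Δ h) = (TensorProduct.comm ℂ A A) (W.Δ h)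
  /-- dual integral relation `⟨ĥ, x (h gL⁻²)⟩ = ε x` -/
  hHat_dual₁ : ∀ x : A, hHat (x * (h * (Ring.inverse gL * Ring.inverse gL))) = W.ε x
  /-- dual integral relation `⟨ĥ, (gR⁻² h) x⟩ = ε x` -/
  hHat_dual₂ : ∀ x : A, hHat ((Ring.inverse gR * Ring.inverse gR * h) * x) = W.ε x
  /-- dual integral relation `⟨ĥ, (h gL⁻²)₍₂₎⟩ (h gL⁻²)₍₁₎ = 1` -/
  hHat_dual₃ : rapp hHat (W.Δ (h * (Ring.inverse gL * Ring.inverse gL))) = 1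
  /-- dual integral relation `⟨ĥ, (gR⁻² h)₍₁₎⟩ (gR⁻² h)₍₂₎ = 1` -/
  hHat_dual₄ : lapp hHat (W.Δ (Ring.inverse gR * Ring.inverse gR * h)) = 1
  /-- the positive square root, via the continuous functional calculus -/
  sqrt : A → A
  sqrt_pos : ∀ x : A, IsPosElem x → IsPosElem (sqrt x)
  sqrt_mul_self : ∀ x : A, IsPosElem x → sqrt x * sqrt x = x
  /-- real powers of `gL`, via the continuous functional calculus -/
  gLpow : ℝ → A
  /-- real powers of `gR`, via the continuous functional calculus -/
  gRpow : ℝ → A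
  gLpow_one : gLpow 1 = gL
  gRpow_one : gRpow 1 = gR
  gLpow_zero : gLpow 0 = 1
  gRpow_zero : gRpow 0 = 1
  gLpow_add : ∀ s t : ℝ, gLpow (s + t) = gLpow s * gLpow t
  gRpow_add : ∀ s t : ℝ, gRpow (s + t) = gRpow s * gRpow t
  gLpow_pos : ∀ t : ℝ, IsPosElem (gLpow t)
  gRpow_pos : ∀ t : ℝ, IsPosElem (gRpow t)
  gLpow_continuous : Continuous gLpow
  gRpow_continuous : Continuous gRpow

namespace HaarPkg

variable {A : Type*} [NormedRing A] [StarRing A] [CStarRing A]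
  [NormedAlgebra ℂ A] [StarModule ℂ A] [FiniteDimensional ℂ A]
variable (P : HaarPkg A)

/-- The canonical grouplike element `g = gL gR⁻¹`. -/
def g : A := P.gL * Ring.inverse P.gR

/-- The Watatani index `ı = ε^L (h gL⁻²)` of the Haar conditional expectations. -/
def iotaEl : A := WeakHopfData.εL P.W (P.h * (Ring.inverse P.gL * Ring.inverse P.gL))

/-- The element `ȷ = ⟨ĥ, (gL⁻²)₍₁₎⟩ (gL⁻²)₍₂₎`, the dual analogue of the Watatani index. -/
def jayEl : A := lapp P.hHat (P.W.Δ (Ring.inverse P.gL * Ring.inverse P.gL))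

/-- The pulling-through element `Ω = ı⁻¹ gL⁻¹ h gL⁻¹`. -/
def Ω : A := Ring.inverse P.iotaEl * Ring.inverse P.gL * P.h * Ring.inverse P.gL

/-- The map `J x = g^{-1/2} S(x) g^{1/2}`, as a linear map. -/
def Jlin : A →ₗ[ℂ] A :=
  LinearMap.mulRight ℂ (P.sqrt P.g) ∘ₗ
    LinearMap.mulLeft ℂ (Ring.inverse (P.sqrt P.g)) ∘ₗ P.W.S.toLinearMap

/-- The functional `⟨ω, x⟩ = ⟨ĥ, ȷ⁻¹ gL⁻¹ gR⁻¹ x⟩` (the dual analogue of `Ω`). -/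
def ω : A →ₗ[ℂ] ℂ :=
  P.hHat ∘ₗ LinearMap.mulLeft ℂ (Ring.inverse P.jayEl * (Ring.inverse P.gL * Ring.inverse P.gR))

/-- `ξ_L = ı^{1/2} ȷ^{1/2} gL`. -/
def ξL : A := P.sqrt P.iotaEl * P.sqrt P.jayEl * P.gL

/-- `ξ_R = ı^{1/2} ȷ^{1/2} gR`. -/
def ξR : A := P.sqrt P.iotaEl * P.sqrt P.jayEl * P.gR

/-- `ξ = ξ_L ξ_R`. -/
def ξ : A := P.ξL * P.ξR

/-- `J^L x = gL⁻¹ S(x) gL`. -/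
def JL : A → A := fun x => Ring.inverse P.gL * P.W.S x * P.gL

/-- `J^R x = gL S⁻¹(x) gL⁻¹`. -/
def JR : A → A := fun x => P.gL * P.W.S.symm x * Ring.inverse P.gL

end HaarPkg

section TensorLegs

open TensorProduct

variable {A : Type*} [NormedRing A] [NormedAlgebra ℂ A]

theorem map_mulLeft_id (a : A) (u : A ⊗[ℂ] A) :
    map (LinearMap.mulLeft ℂ a) LinearMap.id u = (a ⊗ₜ[ℂ] (1 : A)) * u := by
  induction u with
  | zero => simp
  | tmul b c => simp
  | add u v hu hv => simp only [map_add, mul_add, hu, hv]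

theorem map_id_mulLeft (a : A) (u : A ⊗[ℂ] A) :
    map LinearMap.id (LinearMap.mulLeft ℂ a) u = ((1 : A) ⊗ₜ[ℂ] a) * u := by
  induction u with
  | zero => simp
  | tmul b c => simp
  | add u v hu hv => simp only [map_add, mul_add, hu, hv]

theorem map_mulRight_id (a : A) (u : A ⊗[ℂ] A) :
    map (LinearMap.mulRight ℂ a) LinearMap.id u = u * (a ⊗ₜ[ℂ] (1 : A)) := by
  induction u with
  | zero => simp
  | tmul b c => simp
  | add u v hu hv => simp only [map_add, add_mul, hu, hv]

theorem map_id_mulRight (a : A) (u : A ⊗[ℂ] A) :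
    map LinearMap.id (LinearMap.mulRight ℂ a) u = u * ((1 : A) ⊗ₜ[ℂ] a) := by
  induction u with
  | zero => simp
  | tmul b c => simp
  | add u v hu hv => simp only [map_add, add_mul, hu, hv]

theorem assoc_symm_mul (u v : A ⊗[ℂ] (A ⊗[ℂ] A)) :
    (TensorProduct.assoc ℂ A A A).symm (u * v)
      = (TensorProduct.assoc ℂ A A A).symm u * (TensorProduct.assoc ℂ A A A).symm v :=
  map_mul (Algebra.TensorProduct.assoc ℂ ℂ ℂ A A A).symm u v

theorem lid_map_assoc_mul (φ : A →ₗ[ℂ] ℂ) (u v : A ⊗[ℂ] A) :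
    TensorProduct.lid ℂ (A ⊗[ℂ] A) (map φ LinearMap.id (TensorProduct.assoc ℂ A A A
      ((u ⊗ₜ[ℂ] (1 : A)) * (TensorProduct.assoc ℂ A A A).symm ((1 : A) ⊗ₜ[ℂ] v))))
      = (lapp φ u ⊗ₜ[ℂ] (1 : A)) * v := by
  induction u with
  | zero => simp
  | add u u' hu hu' => simp only [add_tmul, map_add, add_mul, hu, hu']
  | tmul a b =>
    induction v with
    | zero => simp
    | add v v' hv hv' => simp only [tmul_add, map_add, mul_add, hv, hv']
    | tmul c d => simp [lapp, smul_tmul']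

theorem lid_map_assoc_mul' (φ : A →ₗ[ℂ] ℂ) (u v : A ⊗[ℂ] A) :
    TensorProduct.lid ℂ (A ⊗[ℂ] A) (map φ LinearMap.id (TensorProduct.assoc ℂ A A A
      ((TensorProduct.assoc ℂ A A A).symm ((1 : A) ⊗ₜ[ℂ] v) * (u ⊗ₜ[ℂ] (1 : A)))))
      = v * (lapp φ u ⊗ₜ[ℂ] (1 : A)) := by
  induction u with
  | zero => simp
  | add u u' hu hu' => simp only [add_tmul, map_add, mul_add, hu, hu']
  | tmul a b =>
    induction v with
    | zero => simp
    | add v v' hv hv' => simp only [tmul_add, map_add, add_mul, hv, hv']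
    | tmul c d => simp [lapp, smul_tmul']

theorem rid_map_mul (φ : A →ₗ[ℂ] ℂ) (u v : A ⊗[ℂ] A) :
    TensorProduct.rid ℂ (A ⊗[ℂ] A) (map LinearMap.id φ
      ((u ⊗ₜ[ℂ] (1 : A)) * (TensorProduct.assoc ℂ A A A).symm ((1 : A) ⊗ₜ[ℂ] v)))
      = u * ((1 : A) ⊗ₜ[ℂ] rapp φ v) := by
  induction v with
  | zero => simp
  | add v v' hv hv' => simp only [tmul_add, map_add, mul_add, hv, hv']
  | tmul c d =>
    induction u with
    | zero => simp
    | add u u' hu hu' => simp only [add_tmul, map_add, add_mul, hu, hu']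
    | tmul a b => simp [rapp]

end TensorLegs

namespace WeakHopfData

open TensorProduct

variable {A : Type*} [NormedRing A] [StarRing A] [CStarRing A]
  [NormedAlgebra ℂ A] [StarModule ℂ A] [FiniteDimensional ℂ A] (W : WeakHopfData A)

theorem Δ_one_mul (x : A) : W.Δ 1 * W.Δ x = W.Δ x := by rw [← W.Δ_mul, one_mul]

theorem Δ_mul_one (x : A) : W.Δ x * W.Δ 1 = W.Δ x := by rw [← W.Δ_mul, mul_one]

theorem map_Δ_id_Δ (x : A) : map W.Δ LinearMap.id (W.Δ x)
    = (TensorProduct.assoc ℂ A A A).symm (map LinearMap.id W.Δ (W.Δ x)) := by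
  rw [LinearEquiv.eq_symm_apply]
  exact LinearMap.congr_fun W.coassoc x

theorem lid_map_ε_Δ (x : A) :
    TensorProduct.lid ℂ A (map W.ε LinearMap.id (W.Δ x)) = x :=
  LinearMap.congr_fun W.counit_left x

theorem rid_map_ε_Δ (x : A) :
    TensorProduct.rid ℂ A (map LinearMap.id W.ε (W.Δ x)) = x :=
  LinearMap.congr_fun W.counit_right x

theorem εL_apply (x : A) : W.εL x = lapp (W.ε ∘ₗ LinearMap.mulRight ℂ x) (W.Δ 1) :=
  W.antipode_left x

theorem εR_apply (x : A) : W.εR x = rapp (W.ε ∘ₗ LinearMap.mulLeft ℂ x) (W.Δ 1) :=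
  W.antipode_right x

theorem εL_one : W.εL 1 = 1 := by
  rw [εL_apply, LinearMap.mulRight_one, LinearMap.comp_id]
  exact W.lid_map_ε_Δ 1

theorem εR_one : W.εR 1 = 1 := by
  rw [εR_apply, LinearMap.mulLeft_one, LinearMap.comp_id]
  exact W.rid_map_ε_Δ 1

/-- Apply the counit to the middle leg of a threefold tensor. -/
def midε : (A ⊗[ℂ] A) ⊗[ℂ] A →ₗ[ℂ] A ⊗[ℂ] A :=
  map ((TensorProduct.rid ℂ A).toLinearMap ∘ₗ map LinearMap.id W.ε) LinearMap.id

theorem midε_tmul (a b c : A) :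
    W.midε ((a ⊗ₜ[ℂ] b) ⊗ₜ[ℂ] c) = (W.ε b • a) ⊗ₜ[ℂ] c := by
  simp [midε]

theorem midε_map_Δ_id (u : A ⊗[ℂ] A) : W.midε (map W.Δ LinearMap.id u) = u := by
  induction u with
  | zero => simp
  | tmul a b =>
    simp only [midε, map_tmul, LinearMap.id_apply, LinearMap.comp_apply, LinearEquiv.coe_coe,
      rid_map_ε_Δ]
  | add u v hu hv => simp only [map_add, hu, hv]

theorem midε_assoc_symm_tmul (a : A) (u : A ⊗[ℂ] A) :
    W.midε ((TensorProduct.assoc ℂ A A A).symm (a ⊗ₜ[ℂ] u))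
      = a ⊗ₜ[ℂ] TensorProduct.lid ℂ A (map W.ε LinearMap.id u) := by
  induction u with
  | zero => simp
  | tmul b c => simp [midε_tmul, smul_tmul]
  | add u v hu hv => simp only [tmul_add, map_add, hu, hv]

theorem midε_assoc_symm_map_id_Δ (u : A ⊗[ℂ] A) :
    W.midε ((TensorProduct.assoc ℂ A A A).symm (map LinearMap.id W.Δ u)) = u := by
  induction u with
  | zero => simp
  | tmul a b => rw [map_tmul, midε_assoc_symm_tmul, lid_map_ε_Δ, LinearMap.id_apply]
  | add u v hu hv => simp only [map_add, hu, hv]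

theorem map_id_Δ_mul (u v : A ⊗[ℂ] A) :
    map LinearMap.id W.Δ (u * v) = map LinearMap.id W.Δ u * map LinearMap.id W.Δ v := by
  induction u with
  | zero => simp
  | add u u' hu hu' => simp only [add_mul, map_add, hu, hu']
  | tmul a b =>
    induction v with
    | zero => simp
    | add v v' hv hv' => simp only [mul_add, map_add, hv, hv']
    | tmul c d => simp [W.Δ_mul]

theorem map_Δ_id_mul (u v : A ⊗[ℂ] A) :
    map W.Δ LinearMap.id (u * v) = map W.Δ LinearMap.id u * map W.Δ LinearMap.id v := by
  induction u with
  | zero => simp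
  | add u u' hu hu' => simp only [add_mul, map_add, hu, hu']
  | tmul a b =>
    induction v with
    | zero => simp
    | add v v' hv hv' => simp only [mul_add, map_add, hv, hv']
    | tmul c d => simp [W.Δ_mul]

theorem map_εR_id (u : A ⊗[ℂ] A) : map W.εR LinearMap.id u
    = W.midε ((TensorProduct.assoc ℂ A A A).symm ((1 : A) ⊗ₜ[ℂ] u) * (W.Δ 1 ⊗ₜ[ℂ] (1 : A))) := by
  induction u with
  | zero => simp
  | add u v hu hv => simp only [map_add, tmul_add, add_mul, hu, hv]
  | tmul a b =>
    rw [map_tmul, εR_apply]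
    generalize W.Δ 1 = t
    induction t with
    | zero => simp
    | add u v hu hv => simp only [map_add, mul_add, add_tmul, hu, hv]
    | tmul c d => simp [rapp, midε_tmul]

theorem map_id_εL (u : A ⊗[ℂ] A) : map LinearMap.id W.εL u
    = W.midε ((TensorProduct.assoc ℂ A A A).symm ((1 : A) ⊗ₜ[ℂ] W.Δ 1) * (u ⊗ₜ[ℂ] (1 : A))) := by
  induction u with
  | zero => simp
  | add u v hu hv => simp only [map_add, add_tmul, mul_add, hu, hv]
  | tmul a b =>
    rw [map_tmul, εL_apply]
    generalize W.Δ 1 = t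
    induction t with
    | zero => simp
    | add u v hu hv => simp only [map_add, add_mul, tmul_add, hu, hv]
    | tmul c d => simp [lapp, midε_tmul, smul_tmul]

/-- `ε^R(x₍₁₎) ⊗ x₍₂₎ = 1₍₁₎ ⊗ x 1₍₂₎`. -/
theorem map_εR_id_Δ (x : A) :
    map W.εR LinearMap.id (W.Δ x) = ((1 : A) ⊗ₜ[ℂ] x) * W.Δ 1 := by
  have key : (1 : A) ⊗ₜ[ℂ] W.Δ x = ((1 : A) ⊗ₜ[ℂ] W.Δ x) * ((1 : A) ⊗ₜ[ℂ] W.Δ 1) := by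
    rw [Algebra.TensorProduct.tmul_mul_tmul, one_mul, Δ_mul_one]
  rw [map_εR_id, key, assoc_symm_mul, mul_assoc, ← W.Δ_one_weak', map_Δ_id_Δ, ← assoc_symm_mul]
  have hx : (1 : A) ⊗ₜ[ℂ] W.Δ x = map LinearMap.id W.Δ ((1 : A) ⊗ₜ[ℂ] x) := by simp
  rw [hx, ← map_id_Δ_mul, midε_assoc_symm_map_id_Δ]

/-- `x₍₁₎ ⊗ ε^L(x₍₂₎) = 1₍₁₎ x ⊗ 1₍₂₎`. -/
theorem map_id_εL_Δ (x : A) :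
    map LinearMap.id W.εL (W.Δ x) = W.Δ 1 * (x ⊗ₜ[ℂ] (1 : A)) := by
  have key : W.Δ x ⊗ₜ[ℂ] (1 : A) = (W.Δ 1 ⊗ₜ[ℂ] (1 : A)) * (W.Δ x ⊗ₜ[ℂ] (1 : A)) := by
    rw [Algebra.TensorProduct.tmul_mul_tmul, one_mul, Δ_one_mul]
  have hx : W.Δ x ⊗ₜ[ℂ] (1 : A) = map W.Δ LinearMap.id (x ⊗ₜ[ℂ] (1 : A)) := by simp
  rw [map_id_εL, key, ← mul_assoc, ← W.Δ_one_weak', hx, ← map_Δ_id_mul, midε_map_Δ_id]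

/-- `ε^R(x₍₁₎) S(x₍₂₎) = S(x)`. -/
theorem mul'_map_εR_S_Δ (x : A) :
    LinearMap.mul' ℂ A (map W.εR W.S.toLinearMap (W.Δ x)) = W.S x := by
  have h₁ : map W.εR W.S.toLinearMap (W.Δ x)
      = map LinearMap.id W.S.toLinearMap (map W.εR LinearMap.id (W.Δ x)) := by
    rw [map_map, LinearMap.id_comp, LinearMap.comp_id]
  have h₂ : ∀ u : A ⊗[ℂ] A,
      LinearMap.mul' ℂ A (map LinearMap.id W.S.toLinearMap (((1 : A) ⊗ₜ[ℂ] x) * u))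
        = LinearMap.mul' ℂ A (map LinearMap.id W.S.toLinearMap u) * W.S x := by
    intro u
    induction u with
    | zero => simp
    | add u v hu hv => simp only [mul_add, map_add, add_mul, hu, hv]
    | tmul a b => simp [W.S_antimul, mul_assoc]
  rw [h₁, map_εR_id_Δ, h₂]
  change W.εL 1 * W.S x = W.S x
  rw [εL_one, one_mul]

/-- `S(x₍₁₎) ε^L(x₍₂₎) = S(x)`. -/
theorem mul'_map_S_εL_Δ (x : A) :
    LinearMap.mul' ℂ A (map W.S.toLinearMap W.εL (W.Δ x)) = W.S x := by
  have h₁ : map W.S.toLinearMap W.εL (W.Δ x)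
      = map W.S.toLinearMap LinearMap.id (map LinearMap.id W.εL (W.Δ x)) := by
    rw [map_map, LinearMap.id_comp, LinearMap.comp_id]
  have h₂ : ∀ u : A ⊗[ℂ] A,
      LinearMap.mul' ℂ A (map W.S.toLinearMap LinearMap.id (u * (x ⊗ₜ[ℂ] (1 : A))))
        = W.S x * LinearMap.mul' ℂ A (map W.S.toLinearMap LinearMap.id u) := by
    intro u
    induction u with
    | zero => simp
    | add u v hu hv => simp only [add_mul, map_add, mul_add, hu, hv]
    | tmul a b => simp [W.S_antimul, mul_assoc]
  rw [h₁, map_id_εL_Δ, h₂]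
  change W.S x * W.εR 1 = W.S x
  rw [εR_one, mul_one]

theorem Δ_lapp (φ : A →ₗ[ℂ] ℂ) (u : A ⊗[ℂ] A) :
    W.Δ (lapp φ u) = TensorProduct.lid ℂ (A ⊗[ℂ] A)
      (map φ LinearMap.id (map LinearMap.id W.Δ u)) := by
  induction u with
  | zero => simp
  | add u v hu hv => simp only [map_add, hu, hv]
  | tmul a b => simp [lapp]

theorem Δ_rapp (φ : A →ₗ[ℂ] ℂ) (u : A ⊗[ℂ] A) :
    W.Δ (rapp φ u) = TensorProduct.rid ℂ (A ⊗[ℂ] A)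
      (map LinearMap.id φ (map W.Δ LinearMap.id u)) := by
  induction u with
  | zero => simp
  | add u v hu hv => simp only [map_add, hu, hv]
  | tmul a b => simp [rapp]

theorem map_id_Δ_Δ_one : map LinearMap.id W.Δ (W.Δ 1)
    = TensorProduct.assoc ℂ A A A (map W.Δ LinearMap.id (W.Δ 1)) := by
  rw [map_Δ_id_Δ, LinearEquiv.apply_symm_apply]

theorem Δ_εL (x : A) : W.Δ (W.εL x) = (W.εL x ⊗ₜ[ℂ] (1 : A)) * W.Δ 1 := by
  rw [εL_apply, Δ_lapp, map_id_Δ_Δ_one, W.Δ_one_weak, lid_map_assoc_mul]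

theorem Δ_εL' (x : A) : W.Δ (W.εL x) = W.Δ 1 * (W.εL x ⊗ₜ[ℂ] (1 : A)) := by
  rw [εL_apply, Δ_lapp, map_id_Δ_Δ_one, W.Δ_one_weak', lid_map_assoc_mul']

theorem Δ_εR (x : A) : W.Δ (W.εR x) = W.Δ 1 * ((1 : A) ⊗ₜ[ℂ] W.εR x) := by
  rw [εR_apply, Δ_rapp, W.Δ_one_weak, rid_map_mul]

theorem Δ_inverse_mul {z : A} (hu : IsUnit z) (hz : W.Δ z = (z ⊗ₜ[ℂ] (1 : A)) * W.Δ 1) (x : A) :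
    W.Δ (Ring.inverse z * x) = (Ring.inverse z ⊗ₜ[ℂ] (1 : A)) * W.Δ x := by
  conv_rhs => rw [← Ring.mul_inverse_cancel_left z x hu, W.Δ_mul, hz, mul_assoc, Δ_one_mul,
    ← mul_assoc, Algebra.TensorProduct.tmul_mul_tmul, Ring.inverse_mul_cancel z hu, one_mul,
    ← Algebra.TensorProduct.one_def, one_mul]

theorem Δ_mul_inverse {z : A} (hu : IsUnit z) (hz : W.Δ z = W.Δ 1 * (z ⊗ₜ[ℂ] (1 : A))) (x : A) :
    W.Δ (x * Ring.inverse z) = W.Δ x * (Ring.inverse z ⊗ₜ[ℂ] (1 : A)) := by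
  conv_rhs => rw [← Ring.inverse_mul_cancel_right z x hu, W.Δ_mul, hz, ← mul_assoc, Δ_mul_one,
    mul_assoc, Algebra.TensorProduct.tmul_mul_tmul, Ring.mul_inverse_cancel z hu, one_mul,
    ← Algebra.TensorProduct.one_def, mul_one]

/-- `a ⊗ (b ⊗ c) ↦ S(a) b ⊗ c`. -/
def antipodeLeftAction : A ⊗[ℂ] (A ⊗[ℂ] A) →ₗ[ℂ] A ⊗[ℂ] A :=
  map (LinearMap.mul' ℂ A ∘ₗ map W.S.toLinearMap LinearMap.id) LinearMap.id ∘ₗ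
    (TensorProduct.assoc ℂ A A A).symm.toLinearMap

theorem antipodeLeftAction_tmul (a : A) (u : A ⊗[ℂ] A) :
    W.antipodeLeftAction (a ⊗ₜ[ℂ] u) = (W.S a ⊗ₜ[ℂ] (1 : A)) * u := by
  induction u with
  | zero => simp
  | add u v hu hv => simp only [tmul_add, map_add, mul_add, hu, hv]
  | tmul b c => simp [antipodeLeftAction]

/-- `(a ⊗ b) ⊗ c ↦ a ⊗ b S(c)`. -/
def antipodeRightAction : (A ⊗[ℂ] A) ⊗[ℂ] A →ₗ[ℂ] A ⊗[ℂ] A :=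
  map LinearMap.id (LinearMap.mul' ℂ A ∘ₗ map LinearMap.id W.S.toLinearMap) ∘ₗ
    (TensorProduct.assoc ℂ A A A).toLinearMap

theorem antipodeRightAction_tmul (u : A ⊗[ℂ] A) (c : A) :
    W.antipodeRightAction (u ⊗ₜ[ℂ] c) = u * ((1 : A) ⊗ₜ[ℂ] W.S c) := by
  induction u with
  | zero => simp
  | add u v hu hv => simp only [add_tmul, map_add, add_mul, hu, hv]
  | tmul a b => simp [antipodeRightAction]

theorem map_εR_id_Δ_eq (x : A) : map W.εR LinearMap.id (W.Δ x)
    = W.antipodeLeftAction (map LinearMap.id W.Δ (W.Δ x)) := by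
  rw [antipodeLeftAction, LinearMap.comp_apply, LinearEquiv.coe_coe, ← map_Δ_id_Δ,
    map_map, LinearMap.id_comp]
  rfl

theorem map_id_εL_Δ_eq (x : A) : map LinearMap.id W.εL (W.Δ x)
    = W.antipodeRightAction (map W.Δ LinearMap.id (W.Δ x)) := by
  rw [antipodeRightAction, LinearMap.comp_apply, LinearEquiv.coe_coe, map_Δ_id_Δ,
    LinearEquiv.apply_symm_apply, map_map, LinearMap.id_comp]
  rfl

/-- `S(x) h₍₁₎ ⊗ h₍₂₎ = h₍₁₎ ⊗ x h₍₂₎` for a left integral `h`. -/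
theorem antipode_mul_Δ {h : A} (hh : ∀ x : A, x * h = W.εL x * h) (x : A) :
    (W.S x ⊗ₜ[ℂ] (1 : A)) * W.Δ h = ((1 : A) ⊗ₜ[ℂ] x) * W.Δ h := by
  have key : ∀ u : A ⊗[ℂ] A, W.antipodeLeftAction (map LinearMap.id W.Δ u) * W.Δ h
      = (LinearMap.mul' ℂ A (map W.S.toLinearMap W.εL u) ⊗ₜ[ℂ] (1 : A)) * W.Δ h := by
    intro u
    induction u with
    | zero => simp
    | add u v hu hv => simp only [map_add, add_mul, add_tmul, hu, hv]
    | tmul a b =>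
      rw [map_tmul, antipodeLeftAction_tmul, LinearMap.id_apply, mul_assoc, ← W.Δ_mul, hh,
        W.Δ_mul, Δ_εL, mul_assoc, Δ_one_mul, ← mul_assoc, Algebra.TensorProduct.tmul_mul_tmul,
        one_mul, map_tmul, LinearMap.mul'_apply, LinearEquiv.coe_coe]
  rw [← W.mul'_map_S_εL_Δ x, ← key, ← map_εR_id_Δ_eq, map_εR_id_Δ, mul_assoc, Δ_one_mul]

/-- `h₍₁₎ x ⊗ h₍₂₎ = h₍₁₎ ⊗ h₍₂₎ S(x)` for a right integral `h`. -/
theorem Δ_mul_antipode {h : A} (hh : ∀ x : A, h * x = h * W.εR x) (x : A) :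
    W.Δ h * (x ⊗ₜ[ℂ] (1 : A)) = W.Δ h * ((1 : A) ⊗ₜ[ℂ] W.S x) := by
  have key : ∀ u : A ⊗[ℂ] A, W.Δ h * W.antipodeRightAction (map W.Δ LinearMap.id u)
      = W.Δ h * ((1 : A) ⊗ₜ[ℂ] LinearMap.mul' ℂ A (map W.εR W.S.toLinearMap u)) := by
    intro u
    induction u with
    | zero => simp
    | add u v hu hv => simp only [map_add, mul_add, tmul_add, hu, hv]
    | tmul a b =>
      rw [map_tmul, antipodeRightAction_tmul, LinearMap.id_apply, ← mul_assoc, ← W.Δ_mul, hh,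
        W.Δ_mul, Δ_εR, ← mul_assoc, Δ_mul_one, mul_assoc, Algebra.TensorProduct.tmul_mul_tmul,
        one_mul, map_tmul, LinearMap.mul'_apply, LinearEquiv.coe_coe]
  rw [← W.mul'_map_εR_S_Δ x, ← key, ← map_id_εL_Δ_eq, map_id_εL_Δ, ← mul_assoc, Δ_mul_one]

/-- `ε^L(h z) = h₍₁₎ z S(h₍₂₎)` is central for a left integral `h` and `z ∈ A^L`. -/
theorem commute_εL_mul {h z : A} (hh : ∀ x : A, x * h = W.εL x * h)
    (hz : ∀ x : A, W.Δ (x * z) = W.Δ x * (z ⊗ₜ[ℂ] (1 : A))) (x : A) :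
    Commute (W.εL (h * z)) x := by
  obtain ⟨y, rfl⟩ := W.S.surjective x
  have h₁ : ∀ u : A ⊗[ℂ] A,
      LinearMap.mul' ℂ A (map LinearMap.id W.S.toLinearMap ((W.S y ⊗ₜ[ℂ] (1 : A)) * u))
        = W.S y * LinearMap.mul' ℂ A (map LinearMap.id W.S.toLinearMap u) := by
    intro u
    induction u with
    | zero => simp
    | add u v hu hv => simp only [mul_add, map_add, hu, hv]
    | tmul a b => simp [mul_assoc]
  have h₂ : ∀ u : A ⊗[ℂ] A,
      LinearMap.mul' ℂ A (map LinearMap.id W.S.toLinearMap (((1 : A) ⊗ₜ[ℂ] y) * u))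
        = LinearMap.mul' ℂ A (map LinearMap.id W.S.toLinearMap u) * W.S y := by
    intro u
    induction u with
    | zero => simp
    | add u v hu hv => simp only [mul_add, map_add, add_mul, hu, hv]
    | tmul a b => simp [W.S_antimul, mul_assoc]
  change LinearMap.mul' ℂ A (map LinearMap.id W.S.toLinearMap (W.Δ (h * z))) * W.S y
    = W.S y * LinearMap.mul' ℂ A (map LinearMap.id W.S.toLinearMap (W.Δ (h * z)))
  rw [← h₁, ← h₂, hz, ← mul_assoc, ← mul_assoc, antipode_mul_Δ W hh]

end WeakHopfData

namespace HaarPkg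

open TensorProduct

variable {A : Type*} [NormedRing A] [StarRing A] [CStarRing A]
  [NormedAlgebra ℂ A] [StarModule ℂ A] [FiniteDimensional ℂ A] (P : HaarPkg A)

theorem Δ_inverse_gL_mul (x : A) :
    P.W.Δ (Ring.inverse P.gL * x) = (Ring.inverse P.gL ⊗ₜ[ℂ] (1 : A)) * P.W.Δ x := by
  obtain ⟨a, ha⟩ := P.gL_mem
  exact P.W.Δ_inverse_mul P.gL_unit (ha ▸ P.W.Δ_εL a) x

theorem Δ_mul_inverse_gL (x : A) :
    P.W.Δ (x * Ring.inverse P.gL) = P.W.Δ x * (Ring.inverse P.gL ⊗ₜ[ℂ] (1 : A)) := by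
  obtain ⟨a, ha⟩ := P.gL_mem
  exact P.W.Δ_mul_inverse P.gL_unit (ha ▸ P.W.Δ_εL' a) x

theorem iotaEl_commute (x : A) : Commute P.iotaEl x := by
  refine P.W.commute_εL_mul P.haar_left (fun y => ?_) x
  rw [← mul_assoc, Δ_mul_inverse_gL, Δ_mul_inverse_gL, mul_assoc,
    Algebra.TensorProduct.tmul_mul_tmul, one_mul]

theorem inverse_iotaEl_commute (x : A) : Commute (Ring.inverse P.iotaEl) x := by
  by_cases hu : IsUnit P.iotaEl
  · obtain ⟨u, hu⟩ := hu
    rw [← hu, Ring.inverse_unit]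
    exact Commute.units_inv_left (hu ▸ P.iotaEl_commute x)
  · rw [Ring.inverse_non_unit _ hu]
    exact Commute.zero_left x

theorem Δ_inverse_iotaEl_mul (x : A) :
    P.W.Δ (Ring.inverse P.iotaEl * x) = (Ring.inverse P.iotaEl ⊗ₜ[ℂ] (1 : A)) * P.W.Δ x := by
  by_cases hu : IsUnit P.iotaEl
  · exact P.W.Δ_inverse_mul hu (P.W.Δ_εL _) x
  · simp [Ring.inverse_non_unit _ hu]

/-- `Δ(Ω) = ı⁻¹ gL⁻¹ h₍₁₎ gL⁻¹ ⊗ h₍₂₎`. -/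
theorem Δ_Ω : P.W.Δ P.Ω = ((Ring.inverse P.iotaEl * Ring.inverse P.gL) ⊗ₜ[ℂ] (1 : A))
    * P.W.Δ P.h * (Ring.inverse P.gL ⊗ₜ[ℂ] (1 : A)) := by
  rw [Ω, Δ_mul_inverse_gL, mul_assoc (Ring.inverse P.iotaEl), Δ_inverse_iotaEl_mul,
    Δ_inverse_gL_mul, ← mul_assoc ((Ring.inverse P.iotaEl) ⊗ₜ[ℂ] (1 : A)),
    Algebra.TensorProduct.tmul_mul_tmul, one_mul]

theorem JL_mul_inverse (x : A) : P.JL x * (Ring.inverse P.iotaEl * Ring.inverse P.gL)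
    = Ring.inverse P.iotaEl * Ring.inverse P.gL * P.W.S x := by
  rw [← mul_assoc, ← (P.inverse_iotaEl_commute (P.JL x)).eq, mul_assoc, JL,
    Ring.mul_inverse_cancel_right _ _ P.gL_unit, mul_assoc]

theorem inverse_mul_JR (y : A) :
    Ring.inverse P.gL * P.JR y = P.W.S.symm y * Ring.inverse P.gL := by
  rw [JR, mul_assoc, Ring.inverse_mul_cancel_left _ _ P.gL_unit]

end HaarPkg

/-- **The pulling-through identities.**
With `J^L x = gL⁻¹ S(x) gL` and `J^R x = gL S⁻¹(x) gL⁻¹`, for all `x, y ∈ A` one has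
`J^L(x) Ω₍₁₎ ⊗ Ω₍₂₎ = Ω₍₁₎ ⊗ x Ω₍₂₎` and `Ω₍₁₎ J^R(y) ⊗ Ω₍₂₎ = Ω₍₁₎ ⊗ Ω₍₂₎ y`. -/
theorem HaarPkg.pulling_through {A : Type*} [NormedRing A] [StarRing A] [CStarRing A]
    [NormedAlgebra ℂ A] [StarModule ℂ A] [FiniteDimensional ℂ A]
    (P : HaarPkg A) (x y : A) :
    TensorProduct.map (LinearMap.mulLeft ℂ (P.JL x)) LinearMap.id (P.W.Δ P.Ω)
      = TensorProduct.map LinearMap.id (LinearMap.mulLeft ℂ x) (P.W.Δ P.Ω) ∧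
    TensorProduct.map (LinearMap.mulRight ℂ (P.JR y)) LinearMap.id (P.W.Δ P.Ω)
      = TensorProduct.map LinearMap.id (LinearMap.mulRight ℂ y) (P.W.Δ P.Ω) := by
  rw [map_mulLeft_id, map_id_mulLeft, map_mulRight_id,
    map_id_mulRight, P.Δ_Ω]
  constructor
  · rw [← mul_assoc, ← mul_assoc, ← mul_assoc, ← mul_assoc,
      Algebra.TensorProduct.tmul_mul_tmul, Algebra.TensorProduct.tmul_mul_tmul, P.JL_mul_inverse,
      one_mul, mul_one, one_mul]
    have h₁ : (Ring.inverse P.iotaEl * Ring.inverse P.gL * P.W.S x) ⊗ₜ[ℂ] (1 : A)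
        = ((Ring.inverse P.iotaEl * Ring.inverse P.gL) ⊗ₜ[ℂ] (1 : A))
          * (P.W.S x ⊗ₜ[ℂ] (1 : A)) := by
      rw [Algebra.TensorProduct.tmul_mul_tmul, one_mul]
    have h₂ : (Ring.inverse P.iotaEl * Ring.inverse P.gL) ⊗ₜ[ℂ] x
        = ((Ring.inverse P.iotaEl * Ring.inverse P.gL) ⊗ₜ[ℂ] (1 : A)) * ((1 : A) ⊗ₜ[ℂ] x) := by
      rw [Algebra.TensorProduct.tmul_mul_tmul, one_mul, mul_one]
    rw [h₁, h₂, mul_assoc _ (P.W.S x ⊗ₜ[ℂ] (1 : A)), P.W.antipode_mul_Δ P.haar_left,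
      ← mul_assoc _ ((1 : A) ⊗ₜ[ℂ] x)]
  · rw [mul_assoc, mul_assoc _ _ ((1 : A) ⊗ₜ[ℂ] y), Algebra.TensorProduct.tmul_mul_tmul,
      Algebra.TensorProduct.tmul_mul_tmul, P.inverse_mul_JR, one_mul, mul_one, one_mul]
    have h₁ : (P.W.S.symm y * Ring.inverse P.gL) ⊗ₜ[ℂ] (1 : A)
        = (P.W.S.symm y ⊗ₜ[ℂ] (1 : A)) * (Ring.inverse P.gL ⊗ₜ[ℂ] (1 : A)) := by
      rw [Algebra.TensorProduct.tmul_mul_tmul, one_mul]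
    have h₂ : Ring.inverse P.gL ⊗ₜ[ℂ] y
        = ((1 : A) ⊗ₜ[ℂ] y) * (Ring.inverse P.gL ⊗ₜ[ℂ] (1 : A)) := by
      rw [Algebra.TensorProduct.tmul_mul_tmul, one_mul, mul_one]
    rw [h₁, h₂, mul_assoc _ (P.W.Δ P.h), mul_assoc _ (P.W.Δ P.h), ← mul_assoc (P.W.Δ P.h),
      ← mul_assoc (P.W.Δ P.h), P.W.Δ_mul_antipode P.haar_right, LinearEquiv.apply_symm_apply]

end
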